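/- Let α be a nonzero real number and let Q be the 3-dimensional real Leibniz algebra with bracket determined by [g,e]=f and [g,f]=αe+f (all other brackets of basis vectors zero). A linear map N : Q → Q is a Nijenhuis operator on Q if and only if its matrix (rows = coordinates of N(e), N(f), N(g) in the basis {e,f,g}) has one of the following forms for real parameters: (1) rows (k₁,0,0), (0,k₁,0), (p₁,0,k₁) with p₁≠0; (2) rows (k₁,k₂,0), (0, k₁+((1+√(1+4α))/2)k₂, 0), (0,0,k₁), when k₂≠0, α≥−1/4 and α≠0; (3) rows (k₁,k₂,0), (0, k₁+((1−√(1+4α))/2)k₂, 0), (0,0,k₁), when k₂≠0, α>−1/4 and α≠0; (4) rows (k₁,0,0), (0,k₁,0), (0,0,p₃); (5) rows (k₁,k₂,0), (αk₂, k₁+k₂, 0), (0,0,p₃); (6) rows (k₁,k₂,0), (((−1+√(1+4α))/2)(p₃−k₁), ((1−√(1+4α))/2)k₂+p₃, 0), (0,0,p₃), when k₂≠((−1+√(1+4α))/(2α))(p₃−k₁), p₃≠k₁, α>−1/4 and α≠0; (7) rows (k₁,k₂,0), (((−1−√(1+4α))/2)(p₃−k₁), ((1+√(1+4α))/2)k₂+p₃,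 0), (0,0,p₃), when k₂≠((−1−√(1+4α))/(2α))(p₃−k₁), p₃≠k₁, α≥−1/4 and α≠0; (8) rows (k₁,0,0), (0,k₁,0), (p₁,p₂,k₁), when p₂≠0 and α<−1/4; (9) rows (k₁,0,0), (0,k₁,0), (p₁,p₂,k₁), when p₂≠0, α≥−1/4, p₁≠((−1+√(1+4α))/2)p₂ and p₁≠((−1−√(1+4α))/2)p₂; (10) rows (k₁, ((1−√(1+4α))/(2α))(k₁−ℓ₂)+((1−√(1+4α))²/(4α²))ℓ₁, 0), (ℓ₁,ℓ₂,0), (((−1−√(1+4α))/2)p₂, p₂, k₁+((1−√(1+4α))/(2α))ℓ₁), when p₂≠0, α≥−1/4 and α≠0; (11) rows (k₁, ((1+√(1+4α))/(2α))(k₁−ℓ₂)+((1+√(1+4α))²/(4α²))ℓ₁, 0), (ℓ₁,ℓ₂,0), (((−1+√(1+4α))/2)p₂, p₂, k₁+((1+√(1+4α))/(2α))ℓ₁), when p₂≠0, α>−1/4 and α≠0. -/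

import Mathlib

/-- Bracket of the 3-dim real Leibniz algebra with [g,e]=f, [g,f]=αe+f
(basis e,f,g ↔ indices 0,1,2). -/
noncomputable def br (α : ℝ) (x y : Fin 3 → ℝ) : Fin 3 → ℝ :=
  ![α * (x 2 * y 1), x 2 * y 0 + x 2 * y 1, 0]

/-- A linear map on `ℝ³` is determined by its values on the standard basis. -/
lemma map_eq_vec3_comb (N : (Fin 3 → ℝ) →ₗ[ℝ] (Fin 3 → ℝ)) (x : Fin 3 → ℝ) :
    N x = x 0 • N ![1, 0, 0] + x 1 • N ![0, 1, 0] + x 2 • N ![0, 0, 1] := by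
  rw [← map_smul, ← map_smul, ← map_smul, ← map_add, ← map_add]
  congr 1
  ext i
  fin_cases i <;> simp

/-- The Nijenhuis identity for `br α`, in terms of the rows of the matrix of `N`. -/
lemma nijenhuis_iff_entries {α : ℝ} {N : (Fin 3 → ℝ) →ₗ[ℝ] (Fin 3 → ℝ)}
    {k₁ k₂ k₃ l₁ l₂ l₃ p₁ p₂ p₃ : ℝ}
    (he : N ![1, 0, 0] = ![k₁, k₂, k₃]) (hf : N ![0, 1, 0] = ![l₁, l₂, l₃])
    (hg : N ![0, 0, 1] = ![p₁, p₂, p₃]) :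
    (∀ x y, br α (N x) (N y) + N (N (br α x y)) = N (br α (N x) y) + N (br α x (N y))) ↔
    ∀ x y : Fin 3 → ℝ, ∀ u v w : ℝ,
      u = α * (y 0 * k₂ + y 1 * l₂ + y 2 * p₂) - (α * y 1 * k₁ + (y 0 + y 1) * l₁) →
      v = (y 0 * k₁ + y 1 * l₁ + y 2 * p₁) + (y 0 * k₂ + y 1 * l₂ + y 2 * p₂)
        - (α * y 1 * k₂ + (y 0 + y 1) * l₂) →
      w = - (α * y 1 * k₃ + (y 0 + y 1) * l₃) →
      (x 0 * k₃ + x 1 * l₃ + x 2 * p₃) * u = x 2 * (u * k₁ + v * l₁ + w * p₁) ∧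
      (x 0 * k₃ + x 1 * l₃ + x 2 * p₃) * v = x 2 * (u * k₂ + v * l₂ + w * p₂) ∧
      (x 0 * k₃ + x 1 * l₃ + x 2 * p₃) * w = x 2 * (u * k₃ + v * l₃ + w * p₃) := by
  have hN (x : Fin 3 → ℝ) : N x = ![x 0 * k₁ + x 1 * l₁ + x 2 * p₁,
      x 0 * k₂ + x 1 * l₂ + x 2 * p₂, x 0 * k₃ + x 1 * l₃ + x 2 * p₃] := by
    rw [map_eq_vec3_comb N x, he, hf, hg]
    ext i
    fin_cases i <;> simp
  refine forall₂_congr fun x y => ?_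
  constructor
  · rintro h u v w rfl rfl rfl
    have h0 := congrFun h 0
    have h1 := congrFun h 1
    have h2 := congrFun h 2
    simp [hN, br] at h0 h1 h2
    refine ⟨?_, ?_, ?_⟩
    · linear_combination h0
    · linear_combination h1
    · linear_combination h2
  · intro h
    obtain ⟨h0, h1, h2⟩ := h _ _ _ rfl rfl rfl
    ext i
    fin_cases i
    · simp [hN, br]
      linear_combination h0
    · simp [hN, br]
      linear_combination h1
    · simp [hN, br]
      linear_combination h2

/-- The algebraic core of the classification: if `M` has rows `(a, b)`, `(c, d)` and annihilates
the commutator of `M` with left multiplication by `g`, then `M` commutes with it, or vanishes, or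
its kernel is an eigenline of it. -/
lemma annihilator_trichotomy {α a b c d p q : ℝ} (hα : α ≠ 0)
    (h1 : (α * b - c) * a + (a + b - d) * c = 0)
    (h2 : (α * b - c) * b + (a + b - d) * d = 0)
    (h3 : (α * (d - a) - c) * a + (c - α * b) * c = 0)
    (h4 : (α * (d - a) - c) * b + (c - α * b) * d = 0)
    (h5 : α * q * a + (p + q) * c = 0)
    (h6 : α * q * b + (p + q) * d = 0) :
    (c = α * b ∧ d = a + b ∧ p = 0 ∧ q = 0) ∨ (a = 0 ∧ b = 0 ∧ c = 0 ∧ d = 0) ∨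
    ∃ t, t ^ 2 + t = α ∧ c = -t * a ∧ d = -t * b ∧ p = t * q := by
  by_cases hab : a = 0 ∧ b = 0
  · obtain ⟨rfl, rfl⟩ := hab
    have hd : d = 0 := by
      have : d ^ 2 = 0 := by linear_combination -h2
      simpa using this
    subst hd
    have hc : c = 0 := by
      have : c ^ 2 = 0 := by linear_combination h3
      simpa using this
    exact Or.inr (Or.inl ⟨rfl, rfl, hc, rfl⟩)
  have cancel {z : ℝ} (ha : z * a = 0) (hb : z * b = 0) : z = 0 := by
    by_contra hz
    exact hab ⟨(mul_eq_zero.1 ha).resolve_left hz, (mul_eq_zero.1 hb).resolve_left hz⟩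
  by_cases hY : a + b - d = 0
  · have hX : α * b - c = 0 := cancel (by linear_combination h1 - c * hY)
      (by linear_combination h2 - d * hY)
    by_cases hz : p + q = 0
    · have hq : α * q = 0 := cancel (by linear_combination h5 - c * hz)
        (by linear_combination h6 - d * hz)
      have hq' : q = 0 := (mul_eq_zero.1 hq).resolve_left hα
      exact Or.inl ⟨by linarith, by linarith, by linarith, hq'⟩
    · obtain ⟨t, ht⟩ : ∃ t, t * (p + q) = α * q := ⟨α * q / (p + q), by field_simp⟩
      have hc : c + t * a = 0 := by
        refine (mul_eq_zero.1 (?_ : (p + q) * (c + t * a) = 0)).resolve_left hz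
        linear_combination h5 + a * ht
      have hd : d + t * b = 0 := by
        refine (mul_eq_zero.1 (?_ : (p + q) * (d + t * b) = 0)).resolve_left hz
        linear_combination h6 + b * ht
      have hb : b ≠ 0 := by
        rintro rfl
        exact hab ⟨by linarith, rfl⟩
      have ht2 : t ^ 2 + t - α = 0 := by
        refine (mul_eq_zero.1 (?_ : b * (t ^ 2 + t - α) = 0)).resolve_left hb
        linear_combination t * hY - hX - hc + t * hd
      have ht0 : t ≠ 0 := by
        rintro rfl
        exact hα (by linarith)
      have hp : p - t * q = 0 := by
        refine (mul_eq_zero.1 (?_ : t * (p - t * q) = 0)).resolve_left ht0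
        linear_combination ht - q * ht2
      exact Or.inr (Or.inr ⟨t, by linarith, by linarith, by linarith, by linarith⟩)
  · obtain ⟨t, ht⟩ : ∃ t, t * (a + b - d) = α * b - c :=
      ⟨(α * b - c) / (a + b - d), by field_simp⟩
    have hc : c + t * a = 0 := by
      refine (mul_eq_zero.1 (?_ : (a + b - d) * (c + t * a) = 0)).resolve_left hY
      linear_combination h1 + a * ht
    have hd : d + t * b = 0 := by
      refine (mul_eq_zero.1 (?_ : (a + b - d) * (d + t * b) = 0)).resolve_left hY
      linear_combination h2 + b * ht
    have ht2 : t ^ 2 + t - α = 0 := by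
      refine (mul_eq_zero.1 (?_ : (a + b - d) * (t ^ 2 + t - α) = 0)).resolve_left hY
      apply cancel
      · linear_combination h3 + (t * a + a) * ht + (α * b - c) * hc
      · linear_combination h4 + (t * b + b) * ht + (α * b - c) * hd
    have ht0 : t ≠ 0 := by
      rintro rfl
      exact hα (by linarith)
    have hp : p - t * q = 0 := by
      refine (mul_eq_zero.1 (?_ : t * (p - t * q) = 0)).resolve_left ht0
      have : α * q - t * (p + q) = 0 := cancel (by linear_combination h5 - (p + q) * hc)
        (by linear_combination h6 - (p + q) * hd)
      linear_combination - this - q * ht2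
    exact Or.inr (Or.inr ⟨t, by linarith, by linarith, by linarith, by linarith⟩)

/-- Parametrisation of the Nijenhuis operators on `br α` by the root `t` of `t ^ 2 + t = α` for
which `t e + f` spans an eigenline, together with two families not involving such a root. -/
lemma nijenhuis_iff_eigenline {α : ℝ} (hα : α ≠ 0) (N : (Fin 3 → ℝ) →ₗ[ℝ] (Fin 3 → ℝ)) :
    (∀ x y, br α (N x) (N y) + N (N (br α x y)) = N (br α (N x) y) + N (br α x (N y))) ↔
    (∃ k₁ k₂ p₃ : ℝ, N ![1, 0, 0] = ![k₁, k₂, 0] ∧ N ![0, 1, 0] = ![α * k₂, k₁ + k₂, 0] ∧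
      N ![0, 0, 1] = ![0, 0, p₃]) ∨
    (∃ k₁ p₁ p₂ : ℝ, N ![1, 0, 0] = ![k₁, 0, 0] ∧ N ![0, 1, 0] = ![0, k₁, 0] ∧
      N ![0, 0, 1] = ![p₁, p₂, k₁]) ∨
    (∃ t k₁ k₂ p₂ p₃ : ℝ, t ^ 2 + t = α ∧ N ![1, 0, 0] = ![k₁, k₂, 0] ∧
      N ![0, 1, 0] = ![t * (p₃ - k₁), p₃ - t * k₂, 0] ∧
      N ![0, 0, 1] = ![t * p₂, p₂, p₃]) := by
  constructor
  · obtain ⟨k₁, k₂, k₃, he⟩ : ∃ a b c, N ![1, 0, 0] = ![a, b, c] :=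
      ⟨_, _, _, List.ofFn_inj.1 rfl⟩
    obtain ⟨l₁, l₂, l₃, hf⟩ : ∃ a b c, N ![0, 1, 0] = ![a, b, c] :=
      ⟨_, _, _, List.ofFn_inj.1 rfl⟩
    obtain ⟨p₁, p₂, p₃, hg⟩ : ∃ a b c, N ![0, 0, 1] = ![a, b, c] :=
      ⟨_, _, _, List.ofFn_inj.1 rfl⟩
    rw [nijenhuis_iff_entries he hf hg]
    intro h
    have H (x y : Fin 3 → ℝ) := h x y _ _ _ rfl rfl rfl
    have commuting (hC : ∀ y : Fin 3 → ℝ,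
        α * (y 0 * k₂ + y 1 * l₂ + y 2 * p₂) - (α * y 1 * k₁ + (y 0 + y 1) * l₁) = 0 ∧
        (y 0 * k₁ + y 1 * l₁ + y 2 * p₁) + (y 0 * k₂ + y 1 * l₂ + y 2 * p₂)
          - (α * y 1 * k₂ + (y 0 + y 1) * l₂) = 0 ∧
        - (α * y 1 * k₃ + (y 0 + y 1) * l₃) = 0) :
        l₁ = α * k₂ ∧ l₂ = k₁ + k₂ ∧ p₁ = 0 ∧ p₂ = 0 ∧ k₃ = 0 ∧ l₃ = 0 := by
      have e := hC ![1, 0, 0]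
      have f := hC ![0, 1, 0]
      have g := hC ![0, 0, 1]
      simp [hα] at e f g
      obtain ⟨e1, e2, e3⟩ := e
      obtain ⟨g1, g2⟩ := g
      subst e3 g1
      refine ⟨by linarith, by linarith, by linarith, rfl, ?_, rfl⟩
      simpa [hα] using f.2.2
    have key : (l₁ = α * k₂ ∧ l₂ = k₁ + k₂ ∧ p₁ = 0 ∧ p₂ = 0 ∧ k₃ = 0 ∧ l₃ = 0) ∨
        (k₃ = 0 ∧ l₃ = 0) := by
      by_cases hk : k₃ = 0
      · by_cases hl : l₃ = 0
        · exact Or.inr ⟨hk, hl⟩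
        · refine Or.inl (commuting fun y => ?_)
          simpa [hl] using H ![0, 1, 0] y
      · refine Or.inl (commuting fun y => ?_)
        simpa [hk] using H ![1, 0, 0] y
    rcases key with ⟨rfl, rfl, rfl, rfl, rfl, rfl⟩ | ⟨rfl, rfl⟩
    · exact Or.inl ⟨_, _, _, he, hf, hg⟩
    obtain ⟨e1, e2, -⟩ := H ![0, 0, 1] ![1, 0, 0]
    obtain ⟨f1, f2, -⟩ := H ![0, 0, 1] ![0, 1, 0]
    obtain ⟨g1, g2, -⟩ := H ![0, 0, 1] ![0, 0, 1]
    simp only [Matrix.cons_val] at e1 e2 f1 f2 g1 g2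
    rcases annihilator_trichotomy (a := k₁ - p₃) (b := k₂) (c := l₁) (d := l₂ - p₃) (p := p₁)
      (q := p₂) hα (by linear_combination -e1) (by linear_combination -e2)
      (by linear_combination -f1) (by linear_combination -f2) (by linear_combination -g1)
      (by linear_combination -g2) with ⟨rfl, h2, rfl, rfl⟩ | ⟨h1, rfl, rfl, h2⟩ |
      ⟨t, ht, h1, h2, rfl⟩
    · obtain rfl : l₂ = k₁ + k₂ := by linarith
      exact Or.inl ⟨_, _, _, he, hf, hg⟩
    · obtain rfl : k₁ = p₃ := by linarith
      obtain rfl : l₂ = k₁ := by linarith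
      exact Or.inr (Or.inl ⟨_, _, _, he, hf, hg⟩)
    · obtain rfl : l₁ = t * (p₃ - k₁) := by linarith
      obtain rfl : l₂ = p₃ - t * k₂ := by linarith
      exact Or.inr (Or.inr ⟨t, _, _, _, _, ht, he, hf, hg⟩)
  · rintro (⟨k₁, k₂, p₃, he, hf, hg⟩ | ⟨k₁, p₁, p₂, he, hf, hg⟩ |
      ⟨t, k₁, k₂, p₂, p₃, rfl, he, hf, hg⟩) <;>
    · rw [nijenhuis_iff_entries he hf hg]
      rintro x y u v w rfl rfl rfl
      refine ⟨?_, ?_, ?_⟩ <;> ring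

theorem nijenhuis_classification_thm2_11 (α : ℝ) (hα : α ≠ 0)
    (N : (Fin 3 → ℝ) →ₗ[ℝ] (Fin 3 → ℝ)) :
    (∀ x y, br α (N x) (N y) + N (N (br α x y)) = N (br α (N x) y) + N (br α x (N y)))
    ↔
    ((∃ k₁ p₁ : ℝ, p₁ ≠ 0 ∧
        N ![1,0,0] = ![k₁,0,0] ∧ N ![0,1,0] = ![0,k₁,0] ∧ N ![0,0,1] = ![p₁,0,k₁]) ∨
     (α ≥ -(1/4) ∧ ∃ k₁ k₂ : ℝ, k₂ ≠ 0 ∧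
        N ![1,0,0] = ![k₁,k₂,0] ∧
        N ![0,1,0] = ![0, k₁ + ((1 + Real.sqrt (1+4*α))/2) * k₂, 0] ∧
        N ![0,0,1] = ![0,0,k₁]) ∨
     (α > -(1/4) ∧ ∃ k₁ k₂ : ℝ, k₂ ≠ 0 ∧
        N ![1,0,0] = ![k₁,k₂,0] ∧
        N ![0,1,0] = ![0, k₁ + ((1 - Real.sqrt (1+4*α))/2) * k₂, 0] ∧
        N ![0,0,1] = ![0,0,k₁]) ∨
     (∃ k₁ p₃ : ℝ,
        N ![1,0,0] = ![k₁,0,0] ∧ N ![0,1,0] = ![0,k₁,0] ∧ N ![0,0,1] = ![0,0,p₃]) ∨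
     (∃ k₁ k₂ p₃ : ℝ,
        N ![1,0,0] = ![k₁,k₂,0] ∧ N ![0,1,0] = ![α*k₂, k₁+k₂, 0] ∧
        N ![0,0,1] = ![0,0,p₃]) ∨
     (α > -(1/4) ∧ ∃ k₁ k₂ p₃ : ℝ,
        k₂ ≠ ((-1 + Real.sqrt (1+4*α))/(2*α)) * (p₃-k₁) ∧ p₃ ≠ k₁ ∧
        N ![1,0,0] = ![k₁,k₂,0] ∧
        N ![0,1,0] = ![((-1 + Real.sqrt (1+4*α))/2) * (p₃-k₁),
          ((1 - Real.sqrt (1+4*α))/2) * k₂ + p₃, 0] ∧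
        N ![0,0,1] = ![0,0,p₃]) ∨
     (α ≥ -(1/4) ∧ ∃ k₁ k₂ p₃ : ℝ,
        k₂ ≠ ((-1 - Real.sqrt (1+4*α))/(2*α)) * (p₃-k₁) ∧ p₃ ≠ k₁ ∧
        N ![1,0,0] = ![k₁,k₂,0] ∧
        N ![0,1,0] = ![((-1 - Real.sqrt (1+4*α))/2) * (p₃-k₁),
          ((1 + Real.sqrt (1+4*α))/2) * k₂ + p₃, 0] ∧
        N ![0,0,1] = ![0,0,p₃]) ∨
     (α < -(1/4) ∧ ∃ k₁ p₁ p₂ : ℝ, p₂ ≠ 0 ∧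
        N ![1,0,0] = ![k₁,0,0] ∧ N ![0,1,0] = ![0,k₁,0] ∧ N ![0,0,1] = ![p₁,p₂,k₁]) ∨
     (α ≥ -(1/4) ∧ ∃ k₁ p₁ p₂ : ℝ, p₂ ≠ 0 ∧
        p₁ ≠ ((-1 + Real.sqrt (1+4*α))/2) * p₂ ∧
        p₁ ≠ ((-1 - Real.sqrt (1+4*α))/2) * p₂ ∧
        N ![1,0,0] = ![k₁,0,0] ∧ N ![0,1,0] = ![0,k₁,0] ∧ N ![0,0,1] = ![p₁,p₂,k₁]) ∨
     (α ≥ -(1/4) ∧ ∃ k₁ ℓ₁ ℓ₂ p₂ : ℝ, p₂ ≠ 0 ∧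
        N ![1,0,0] = ![k₁, ((1 - Real.sqrt (1+4*α))/(2*α)) * (k₁-ℓ₂) +
          ((1 - Real.sqrt (1+4*α))^2/(4*α^2)) * ℓ₁, 0] ∧
        N ![0,1,0] = ![ℓ₁,ℓ₂,0] ∧
        N ![0,0,1] = ![((-1 - Real.sqrt (1+4*α))/2) * p₂, p₂,
          k₁ + ((1 - Real.sqrt (1+4*α))/(2*α)) * ℓ₁]) ∨
     (α > -(1/4) ∧ ∃ k₁ ℓ₁ ℓ₂ p₂ : ℝ, p₂ ≠ 0 ∧
        N ![1,0,0] = ![k₁, ((1 + Real.sqrt (1+4*α))/(2*α)) * (k₁-ℓ₂) +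
          ((1 + Real.sqrt (1+4*α))^2/(4*α^2)) * ℓ₁, 0] ∧
        N ![0,1,0] = ![ℓ₁,ℓ₂,0] ∧
        N ![0,0,1] = ![((-1 + Real.sqrt (1+4*α))/2) * p₂, p₂,
          k₁ + ((1 + Real.sqrt (1+4*α))/(2*α)) * ℓ₁])) := by
  rw [nijenhuis_iff_eigenline hα]
  have hsq (h : α ≥ -(1 / 4)) : Real.sqrt (1 + 4 * α) ^ 2 = 1 + 4 * α :=
    Real.sq_sqrt (by linarith)
  have hs0 : 0 ≤ Real.sqrt (1 + 4 * α) := Real.sqrt_nonneg _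
  have hspos (h : 0 < Real.sqrt (1 + 4 * α)) : α > -(1 / 4) := by
    have := Real.sqrt_pos.1 h
    linarith
  generalize Real.sqrt (1 + 4 * α) = s at *
  constructor
  · rintro (⟨k₁, k₂, p₃, he, hf, hg⟩ | ⟨k₁, p₁, p₂, he, hf, hg⟩ |
      ⟨t, k₁, k₂, p₂, p₃, ht, he, hf, hg⟩)
    · exact Or.inr (Or.inr (Or.inr (Or.inr (Or.inl ⟨_, _, _, he, hf, hg⟩))))
    · by_cases hp₂ : p₂ = 0
      · subst hp₂
        by_cases hp₁ : p₁ = 0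
        · subst hp₁
          exact Or.inr (Or.inr (Or.inr (Or.inl ⟨_, _, he, hf, hg⟩)))
        · exact Or.inl ⟨_, _, hp₁, he, hf, hg⟩
      rcases lt_or_ge α (-(1 / 4)) with hα4 | hα4
      · iterate 7 right
        exact Or.inl ⟨hα4, _, _, _, hp₂, he, hf, hg⟩
      by_cases hm : p₁ = (-1 - s) / 2 * p₂
      · iterate 9 right
        refine Or.inl ⟨hα4, k₁, 0, k₁, p₂, hp₂, ?_, hf, ?_⟩
        · simpa using he
        · simpa [hm] using hg
      by_cases hp : p₁ = (-1 + s) / 2 * p₂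
      · iterate 10 right
        refine ⟨hspos (lt_of_le_of_ne hs0 ?_), k₁, 0, k₁, p₂, hp₂, ?_, hf, ?_⟩
        · rintro rfl
          exact hm (by simpa using hp)
        · simpa using he
        · simpa [hp] using hg
      iterate 8 right
      exact Or.inl ⟨hα4, _, _, _, hp₂, hp, hm, he, hf, hg⟩
    · have hα4 : α ≥ -(1 / 4) := by nlinarith [sq_nonneg (2 * t + 1)]
      specialize hsq hα4
      have ht0 : t ≠ 0 := by
        rintro rfl
        exact hα (by linarith)
      have ht1 : t + 1 ≠ 0 := fun h => hα (by linear_combination t * h - ht)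
      have hroot : (t = (-1 - s) / 2) ∨ (t = (-1 + s) / 2 ∧ 0 < s) := by
        rcases eq_or_ne t ((-1 - s) / 2) with h | h
        · exact Or.inl h
        · have hz : (2 * t + 1 + s) * (2 * t + 1 - s) = 0 := by
            linear_combination 4 * ht - hsq
          rcases mul_eq_zero.1 hz with h' | h'
          · exact absurd (by linarith) h
          · refine Or.inr ⟨by linarith, lt_of_le_of_ne hs0 ?_⟩
            rintro rfl
            exact h (by linarith)
      by_cases hp₂ : p₂ = 0
      · subst hp₂
        rw [mul_zero] at hg
        by_cases hp₃ : p₃ = k₁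
        · subst hp₃
          rw [sub_self, mul_zero] at hf
          by_cases hk₂ : k₂ = 0
          · subst hk₂
            rw [mul_zero, sub_zero] at hf
            exact Or.inr (Or.inr (Or.inr (Or.inl ⟨_, _, he, hf, hg⟩)))
          rcases hroot with rfl | ⟨rfl, hs⟩
          · refine Or.inr (Or.inl ⟨hα4, _, _, hk₂, he, ?_, hg⟩)
            rw [hf]
            congr 2
            ring
          · refine Or.inr (Or.inr (Or.inl ⟨hspos hs, _, _, hk₂, he, ?_, hg⟩))
            rw [hf]
            congr 2
            ring
        by_cases hk₂ : k₂ = t / α * (p₃ - k₁)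
        · iterate 4 right
          refine Or.inl ⟨_, _, _, he, ?_, hg⟩
          have hα' : α * k₂ = t * (p₃ - k₁) := by
            rw [hk₂]
            field_simp
          have hk : (t + 1) * k₂ = p₃ - k₁ := by
            apply mul_left_cancel₀ ht0
            linear_combination hα' + k₂ * ht
          rw [hf, hα']
          congr 2
          linear_combination -hk
        rcases hroot with rfl | ⟨rfl, hs⟩
        · iterate 6 right
          refine Or.inl ⟨hα4, _, _, _, ?_, hp₃, he, ?_, hg⟩
          · rwa [← div_div]
          · rw [hf]
            congr 2
            ring
        · iterate 5 right
          refine Or.inl ⟨hspos hs, _, _, _, ?_, hp₃, he, ?_, hg⟩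
          · rwa [← div_div]
          · rw [hf]
            congr 2
            ring
      have hinv : (t + 1) / α = 1 / t := by
        rw [← ht]
        field_simp
      rcases hroot with rfl | ⟨rfl, hs⟩
      · have hr : (1 - s) / (2 * α) = 1 / ((-1 - s) / 2) := by
          rw [← hinv]
          field_simp
          ring
        have hr2 : (1 - s) ^ 2 / (4 * α ^ 2) = (1 / ((-1 - s) / 2)) ^ 2 := by
          rw [← hr, div_pow]
          ring
        iterate 9 right
        refine Or.inl ⟨hα4, k₁, _, _, _, hp₂, ?_, hf, ?_⟩
        · rw [he, hr, hr2]
          congr 2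
          generalize (-1 - s) / 2 = t at *
          field_simp
          ring
        · rw [hg, hr]
          congr 3
          generalize (-1 - s) / 2 = t at *
          field_simp
          ring
      · have hr : (1 + s) / (2 * α) = 1 / ((-1 + s) / 2) := by
          rw [← hinv]
          field_simp
          ring
        have hr2 : (1 + s) ^ 2 / (4 * α ^ 2) = (1 / ((-1 + s) / 2)) ^ 2 := by
          rw [← hr, div_pow]
          ring
        iterate 10 right
        refine ⟨hspos hs, k₁, _, _, _, hp₂, ?_, hf, ?_⟩
        · rw [he, hr, hr2]
          congr 2
          generalize (-1 + s) / 2 = t at *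
          field_simp
          ring
        · rw [hg, hr]
          congr 3
          generalize (-1 + s) / 2 = t at *
          field_simp
          ring
  · have hroot₁ (h : α ≥ -(1 / 4)) : ((-1 - s) / 2) ^ 2 + (-1 - s) / 2 = α := by
      linear_combination hsq h / 4
    have hroot₂ (h : α ≥ -(1 / 4)) : ((-1 + s) / 2) ^ 2 + (-1 + s) / 2 = α := by
      linear_combination hsq h / 4
    rintro (⟨k₁, p₁, -, he, hf, hg⟩ | ⟨h, k₁, k₂, -, he, hf, hg⟩ | ⟨h, k₁, k₂, -, he, hf, hg⟩ |
      ⟨k₁, p₃, he, hf, hg⟩ | h | ⟨h, k₁, k₂, p₃, -, -, he, hf, hg⟩ |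
      ⟨h, k₁, k₂, p₃, -, -, he, hf, hg⟩ | ⟨-, k₁, p₁, p₂, -, he, hf, hg⟩ |
      ⟨-, k₁, p₁, p₂, -, -, -, he, hf, hg⟩ | ⟨h, k₁, l₁, l₂, p₂, -, he, hf, hg⟩ |
      ⟨h, k₁, l₁, l₂, p₂, -, he, hf, hg⟩)
    · exact Or.inr (Or.inl ⟨_, _, _, he, hf, hg⟩)
    · refine Or.inr (Or.inr ⟨_, k₁, k₂, 0, k₁, hroot₁ h, he, ?_, ?_⟩)
      · rw [hf]
        congr! 2 <;> ring_nf
      · rw [hg, mul_zero]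
    · refine Or.inr (Or.inr ⟨_, k₁, k₂, 0, k₁, hroot₂ h.le, he, ?_, ?_⟩)
      · rw [hf]
        congr! 2 <;> ring_nf
      · rw [hg, mul_zero]
    · exact Or.inl ⟨k₁, 0, p₃, he, by simpa using hf, hg⟩
    · exact Or.inl h
    · refine Or.inr (Or.inr ⟨_, k₁, k₂, 0, p₃, hroot₂ h.le, he, ?_, ?_⟩)
      · rw [hf]
        congr! 2
        ring_nf
      · rw [hg, mul_zero]
    · refine Or.inr (Or.inr ⟨_, k₁, k₂, 0, p₃, hroot₁ h, he, ?_, ?_⟩)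
      · rw [hf]
        congr! 2
        ring_nf
      · rw [hg, mul_zero]
    · exact Or.inr (Or.inl ⟨_, _, _, he, hf, hg⟩)
    · exact Or.inr (Or.inl ⟨_, _, _, he, hf, hg⟩)
    · have hr : (-1 - s) / 2 * ((1 - s) / (2 * α)) = 1 := by
        field_simp
        linear_combination hsq h
      refine Or.inr (Or.inr ⟨_, _, _, _, _, hroot₁ h, he, ?_, hg⟩)
      have hr2 : (1 - s) ^ 2 / (4 * α ^ 2) = ((1 - s) / (2 * α)) ^ 2 := by
        rw [div_pow]
        ring
      rw [hf, hr2]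
      generalize (1 - s) / (2 * α) = r at *
      congr! 2
      · linear_combination -l₁ * hr
      · linear_combination (k₁ - l₂ + r * l₁) * hr
    · have hr : (-1 + s) / 2 * ((1 + s) / (2 * α)) = 1 := by
        field_simp
        linear_combination hsq h.le
      refine Or.inr (Or.inr ⟨_, _, _, _, _, hroot₂ h.le, he, ?_, hg⟩)
      have hr2 : (1 + s) ^ 2 / (4 * α ^ 2) = ((1 + s) / (2 * α)) ^ 2 := by
        rw [div_pow]
        ring
      rw [hf, hr2]
      generalize (1 + s) / (2 * α) = r at *
      congr! 2
      · linear_combination -l₁ * hr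
      · linear_combination (k₁ - l₂ + r * l₁) * hr
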